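/- Token-free enabling paths avoiding the regeneration transition: let (TN,μ) be a perpetual T-system with regeneration cluster cl, and let t_cl be the unique transition of cl. Let t be a transition of TN having a pre-place p ∈ •t with μ(p) = 1 and a pre-place q ∈ •t with μ(q) = 0. Then there exist a transition τ enabled at μ and an elementary path δ = (τ,…,q,t) of TN ending in the edge (q,t) with token count ‖μ‖_δ = 0 and such that the initial segment δ_seg = (τ,…,q) of δ does not contain t_cl. -/

import Mathlib

open Classical

/-- A (finite, bipartite) Petri *net*: disjoint finite sets of places and
transitions, and an edge relation running only between places and transitions. -/
structure Net (α : Type*) where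
  places : Finset α
  transitions : Finset α
  F : α → α → Prop
  disj : Disjoint places transitions
  edges : ∀ x y, F x y →
    (x ∈ places ∧ y ∈ transitions) ∨ (x ∈ transitions ∧ y ∈ places)

namespace Net

variable {α : Type*} [DecidableEq α]

/-- The nodes of a net. -/
def nodes (N : Net α) : Finset α := N.places ∪ N.transitions

/-- Pre-set of a node. -/
def pre (N : Net α) (x : α) : Set α := {y | N.F y x}

/-- Post-set of a node. -/
def post (N : Net α) (x : α) : Set α := {y | N.F x y}

/-- A transition `t` is enabled at a marking `μ` if every pre-place is marked. -/
def Enabled (N : Net α) (μ : α → ℕ) (t : α) : Prop :=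
  t ∈ N.transitions ∧ ∀ p, N.F p t → 1 ≤ μ p

/-- Firing a transition: remove one token from each pre-place,
add one token at each post-place. -/
noncomputable def fire (N : Net α) (t : α) (μ : α → ℕ) : α → ℕ :=
  fun p => μ p - (if N.F p t then 1 else 0) + (if N.F t p then 1 else 0)

/-- `FireSeq N μ σ ν`: the occurrence sequence `σ` is enabled at `μ` and
firing it successively leads from `μ` to `ν`. -/
inductive FireSeq (N : Net α) : (α → ℕ) → List α → (α → ℕ) → Prop
  | nil (μ : α → ℕ) : FireSeq N μ [] μ
  | cons {μ ν : α → ℕ} {t : α} {σ : List α} :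
      N.Enabled μ t → FireSeq N (N.fire t μ) σ ν → FireSeq N μ (t :: σ) ν

/-- Reachability of markings. -/
def Reach (N : Net α) (μ ν : α → ℕ) : Prop := ∃ σ : List α, N.FireSeq μ σ ν

/-- The set of transitions enabled at `μ`. -/
def en (N : Net α) (μ : α → ℕ) : Set α := {t | N.Enabled μ t}

/-- Equality of markings (as maps on the places of the net). -/
def MarkingEq (N : Net α) (μ ν : α → ℕ) : Prop := ∀ p ∈ N.places, μ p = ν p

/-- Liveness of a Petri net `(N, μ₀)`. -/
def Live (N : Net α) (μ₀ : α → ℕ) : Prop :=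
  ∀ t ∈ N.transitions, ∀ μ, N.Reach μ₀ μ → ∃ ν, N.Reach μ ν ∧ N.Enabled ν t

/-- Boundedness of a Petri net `(N, μ₀)`. -/
def Bounded (N : Net α) (μ₀ : α → ℕ) : Prop :=
  ∃ K : ℕ, ∀ μ, N.Reach μ₀ μ → ∀ p ∈ N.places, μ p ≤ K

/-- A net is well-formed if it carries a live and bounded marking. -/
def WellFormed (N : Net α) : Prop := ∃ μ₀ : α → ℕ, N.Live μ₀ ∧ N.Bounded μ₀

/-- Free-choice net: `(p,t) ∈ F` implies `•t × p• ⊆ F`. -/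
def FreeChoice (N : Net α) : Prop :=
  ∀ p ∈ N.places, ∀ t, N.F p t → ∀ p', N.F p' t → ∀ t', N.F p t' → N.F p' t'

/-- T-net: every place has exactly one pre-transition and one post-transition. -/
def IsTNet (N : Net α) : Prop :=
  ∀ p ∈ N.places, (∃! t, N.F t p) ∧ (∃! t, N.F p t)

/-- A set of nodes is cluster-closed if with each place it contains the
post-set of the place and with each transition the pre-set of the transition. -/
def ClusterClosed (N : Net α) (S : Set α) : Prop :=
  (∀ p ∈ S, p ∈ N.places → ∀ t, N.F p t → t ∈ S) ∧
  (∀ t ∈ S, t ∈ N.transitions → ∀ p, N.F p t → p ∈ S)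

/-- The cluster of a node: the smallest cluster-closed set of nodes containing it. -/
def clusterOf (N : Net α) (x : α) : Set α :=
  ⋂₀ {S : Set α | x ∈ S ∧ N.ClusterClosed S}

/-- `cl` is a cluster of `N` if it is the cluster of some node. -/
def IsCluster (N : Net α) (cl : Set α) : Prop :=
  ∃ x ∈ N.nodes, cl = N.clusterOf x

/-- The marking `μ_cl` marking exactly the places of the cluster `cl`, once. -/
noncomputable def clusterMarking (N : Net α) (cl : Set α) : α → ℕ :=
  fun p => if p ∈ cl ∧ p ∈ N.places then 1 else 0

/-- `μh` is a home marking of `(N, μ₀)`: reachable from every reachable marking. -/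
def IsHomeMarking (N : Net α) (μ₀ μh : α → ℕ) : Prop :=
  ∀ μ, N.Reach μ₀ μ → ∃ ν, N.Reach μ ν ∧ N.MarkingEq ν μh

/-- `(N, μ₀)` is perpetual with regeneration cluster `cl`: live, bounded, and
`μ_cl` is a home marking for the cluster `cl`. -/
def Perpetual (N : Net α) (μ₀ : α → ℕ) (cl : Set α) : Prop :=
  N.Live μ₀ ∧ N.Bounded μ₀ ∧ N.IsCluster cl ∧
    N.IsHomeMarking μ₀ (N.clusterMarking cl)

/-- Lucency: enabling-equivalent reachable markings are equal. -/
def Lucent (N : Net α) (μ₀ : α → ℕ) : Prop :=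
  ∀ μ₁ μ₂, N.Reach μ₀ μ₁ → N.Reach μ₀ μ₂ → N.en μ₁ = N.en μ₂ → N.MarkingEq μ₁ μ₂

/-- A path of the net: a nonempty sequence of nodes along edges. -/
def IsPath (N : Net α) (δ : List α) : Prop :=
  δ ≠ [] ∧ (∀ x ∈ δ, x ∈ N.nodes) ∧ δ.Chain' N.F

/-- A circuit: a path whose last node is connected back to its first node. -/
def IsCircuit (N : Net α) (δ : List α) : Prop :=
  N.IsPath δ ∧ ∃ h : δ ≠ [], N.F (δ.getLast h) (δ.head h)

/-- Token count of a set of nodes: total number of tokens on its places. -/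
def tokenCount (N : Net α) (μ : α → ℕ) (X : Finset α) : ℕ :=
  ∑ p ∈ X ∩ N.places, μ p

/-- The set `S` of nodes is strongly connected (in the induced subnet). -/
def StronglyConnectedOn (N : Net α) (S : Finset α) : Prop :=
  ∀ x ∈ S, ∀ y ∈ S,
    Relation.ReflTransGen (fun a b => a ∈ S ∧ b ∈ S ∧ N.F a b) x y

/-- The set `S` of nodes is weakly connected (in the induced subnet). -/
def WeaklyConnectedOn (N : Net α) (S : Finset α) : Prop :=
  ∀ x ∈ S, ∀ y ∈ S,
    Relation.ReflTransGen (fun a b => a ∈ S ∧ b ∈ S ∧ (N.F a b ∨ N.F b a)) x y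

/-- The (full) subnet spanned by `S` is transition-bordered: every place of `S`
has all its neighbours inside `S`. -/
def TransitionBordered (N : Net α) (S : Finset α) : Prop :=
  ∀ p ∈ S, p ∈ N.places → ∀ y, (N.F y p ∨ N.F p y) → y ∈ S

/-- The full subnet spanned by `S` is a T-net: each place of `S` has exactly one
pre-transition and one post-transition inside `S`. -/
def TNetOn (N : Net α) (S : Finset α) : Prop :=
  ∀ p ∈ S, p ∈ N.places →
    (∃! t, t ∈ S ∧ N.F t p) ∧ (∃! t, t ∈ S ∧ N.F p t)

/-- `S` spans a CP-subnet of `N`: nonempty, weakly connected, transition-bordered,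
a T-net, and the complement contains a transition and is strongly connected. -/
def IsCPSubnet (N : Net α) (S : Finset α) : Prop :=
  S.Nonempty ∧ S ⊆ N.nodes ∧ N.WeaklyConnectedOn S ∧ N.TransitionBordered S ∧
  N.TNetOn S ∧ ((N.nodes \ S) ∩ N.transitions).Nonempty ∧
  N.StronglyConnectedOn (N.nodes \ S)

/-- The full subnet of `N` spanned by the node set `S`, as a net. -/
def restrict (N : Net α) (S : Finset α) : Net α where
  places := N.places ∩ S
  transitions := N.transitions ∩ S
  F := fun x y => x ∈ S ∧ y ∈ S ∧ N.F x y
  disj := N.disj.mono Finset.inter_subset_left Finset.inter_subset_left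
  edges := by
    rintro x y ⟨hx, hy, hF⟩
    rcases N.edges x y hF with ⟨h1, h2⟩ | ⟨h1, h2⟩
    · exact Or.inl ⟨Finset.mem_inter.mpr ⟨h1, hx⟩, Finset.mem_inter.mpr ⟨h2, hy⟩⟩
    · exact Or.inr ⟨Finset.mem_inter.mpr ⟨h1, hx⟩, Finset.mem_inter.mpr ⟨h2, hy⟩⟩

/-- A CP-exhaustion: a family of pairwise disjoint CP-subnets whose complement
is a strongly connected T-net. -/
def IsCPExhaustion (N : Net α) {n : ℕ}
    (Nhat : Fin n → Finset α) : Prop :=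
  (∀ i, N.IsCPSubnet (Nhat i)) ∧
  (∀ i j, i ≠ j → Disjoint (Nhat i) (Nhat j)) ∧
  N.StronglyConnectedOn (N.nodes \ Finset.univ.biUnion Nhat) ∧
  N.TNetOn (N.nodes \ Finset.univ.biUnion Nhat)

/-- `t` is a way-in transition of the subnet spanned by `S`: a transition of `S`
with a pre-place outside `S`. -/
def IsWayIn (N : Net α) (S : Finset α) (t : α) : Prop :=
  t ∈ S ∧ t ∈ N.transitions ∧ ∃ p ∈ N.places, p ∉ S ∧ N.F p t

/-- A shutdown sequence for the subnet spanned by `S` (with way-in transition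
`tin`) at a marking `μ`: an occurrence sequence enabled at `μ` using only
transitions of `S` other than `tin`, after which no transition of `S` other
than (possibly) `tin` is enabled. -/
def IsShutdownSeq (N : Net α) (S : Finset α) (tin : α)
    (μ : α → ℕ) (σ : List α) (μsd : α → ℕ) : Prop :=
  N.FireSeq μ σ μsd ∧
  (∀ t ∈ σ, t ∈ S ∧ t ∈ N.transitions ∧ t ≠ tin) ∧
  (∀ t ∈ S, t ∈ N.transitions → t ≠ tin → ¬ N.Enabled μsd t)

/-- `C` spans a P-component of `N`: nonempty, strongly connected, inside `C`
every transition has exactly one pre-place and one post-place, and every place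
of `C` has all its neighbours inside `C`. -/
def IsPComponent (N : Net α) (C : Finset α) : Prop :=
  C.Nonempty ∧ C ⊆ N.nodes ∧ N.StronglyConnectedOn C ∧
  (∀ t ∈ C, t ∈ N.transitions →
    (∃! p, p ∈ C ∧ N.F p t) ∧ (∃! p, p ∈ C ∧ N.F t p)) ∧
  (∀ p ∈ C, p ∈ N.places → ∀ y, (N.F y p ∨ N.F p y) → y ∈ C)

end Net

namespace Net

section Auxiliary

variable {α : Type*} {N : Net α}

theorem mem_places_of_edge {r s : α} (hs : s ∈ N.transitions) (h : N.F r s) : r ∈ N.places := by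
  rcases N.edges r s h with h' | h'
  · exact h'.1
  · exact absurd hs (Finset.disjoint_left.1 N.disj h'.2)

theorem pre_mem_transitions {r u : α} (hr : r ∈ N.places) (h : N.F u r) : u ∈ N.transitions := by
  rcases N.edges u r h with h' | h'
  · exact absurd h'.2 (Finset.disjoint_left.1 N.disj hr)
  · exact h'.1

theorem post_mem_transitions {r s : α} (hr : r ∈ N.places) (h : N.F r s) : s ∈ N.transitions := by
  rcases N.edges r s h with h' | h'
  · exact h'.2
  · exact absurd h'.1 (Finset.disjoint_left.1 N.disj hr)

theorem ne_of_mem_places_of_mem_transitions {r s : α} (hr : r ∈ N.places)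
    (hs : s ∈ N.transitions) : r ≠ s :=
  fun h => Finset.disjoint_left.1 N.disj hr (h ▸ hs)

namespace IsTNet

theorem pre_unique (hT : N.IsTNet) {r u v : α} (hr : r ∈ N.places)
    (hu : N.F u r) (hv : N.F v r) : u = v :=
  (hT r hr).1.unique hu hv

theorem post_unique (hT : N.IsTNet) {r s v : α} (hr : r ∈ N.places)
    (hs : N.F r s) (hv : N.F r v) : s = v :=
  (hT r hr).2.unique hs hv

end IsTNet

theorem FireSeq.append {μ ν ξ : α → ℕ} {σ ρ : List α} (h : N.FireSeq μ σ ν)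
    (h' : N.FireSeq ν ρ ξ) : N.FireSeq μ (σ ++ ρ) ξ := by
  induction h with
  | nil => exact h'
  | cons he _ ih => exact .cons he (ih h')

theorem Reach.trans {μ ν ξ : α → ℕ} (h : N.Reach μ ν) (h' : N.Reach ν ξ) : N.Reach μ ξ :=
  let ⟨_, hσ⟩ := h
  let ⟨_, hρ⟩ := h'
  ⟨_, hσ.append hρ⟩

/-- In a bounded net, a transition with a post-place has a pre-place. -/
theorem Bounded.exists_pre {μ : α → ℕ} (hb : N.Bounded μ) {u r : α} (hr : r ∈ N.places)
    (hur : N.F u r) : ∃ r', N.F r' u := by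
  by_contra! hno
  have hreach : ∀ n : ℕ, ∃ ν, N.Reach μ ν ∧ n ≤ ν r := by
    intro n
    induction n with
    | zero => exact ⟨μ, ⟨[], .nil μ⟩, Nat.zero_le _⟩
    | succ n ih =>
      obtain ⟨ν, hν, hn⟩ := ih
      refine ⟨N.fire u ν, hν.trans ⟨[u], .cons ?_ (.nil _)⟩, ?_⟩
      · exact ⟨pre_mem_transitions hr hur, fun p hp => absurd hp (hno p)⟩
      · simp only [fire, if_neg (hno r), if_pos hur]
        omega
  obtain ⟨K, hK⟩ := hb
  obtain ⟨ν, hν, hn⟩ := hreach (K + 1)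
  have := hK ν hν r hr
  omega

/-- In a T-net, the places of a cluster are the pre-places of any of its transitions. -/
theorem IsTNet.mem_cluster_iff (hT : N.IsTNet) [DecidableEq α] {cl : Set α}
    (hcl : N.IsCluster cl) {tcl : α} (hmem : tcl ∈ cl) (htr : tcl ∈ N.transitions)
    {r : α} (hr : r ∈ N.places) : r ∈ cl ↔ N.F r tcl := by
  obtain ⟨x, hx, rfl⟩ := hcl
  constructor
  · intro hrcl
    have hclosed : ∀ s ∈ N.transitions, N.ClusterClosed {y | y = s ∨ N.F y s} := by
      refine fun s hs => ⟨fun a ha hap v hav => ?_, fun a ha hat v hva => ?_⟩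
      · rcases ha with rfl | ha
        · exact absurd rfl (ne_of_mem_places_of_mem_transitions hap hs)
        · exact Or.inl (hT.post_unique hap hav ha)
      · rcases ha with rfl | ha
        · exact Or.inr hva
        · exact absurd rfl
            (ne_of_mem_places_of_mem_transitions (mem_places_of_edge hs ha) hat)
    obtain ⟨s, hs, hxs⟩ : ∃ s ∈ N.transitions, x = s ∨ N.F x s := by
      rcases Finset.mem_union.1 hx with hxp | hxt
      · obtain ⟨s, hs⟩ := (hT x hxp).2.exists
        exact ⟨s, post_mem_transitions hxp hs, Or.inr hs⟩
      · exact ⟨x, hxt, Or.inl rfl⟩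
    have hsub := Set.sInter_subset_of_mem
      (show {y | y = s ∨ N.F y s} ∈ {S : Set α | x ∈ S ∧ N.ClusterClosed S} from
        ⟨hxs, hclosed s hs⟩)
    have hts : tcl = s := (hsub hmem).resolve_right fun h =>
      ne_of_mem_places_of_mem_transitions (mem_places_of_edge hs h) htr rfl
    rw [hts]
    exact (hsub hrcl).resolve_left (ne_of_mem_places_of_mem_transitions hr hs)
  · intro hF S hS
    exact hS.2.2 tcl (hmem S hS) htr r hF

/-- The marking equation for a single place of a T-net. -/
theorem FireSeq.marking_add_count [DecidableEq α] (hT : N.IsTNet) {μ ν : α → ℕ} {σ : List α}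
    (h : N.FireSeq μ σ ν) {u r s : α} (hr : r ∈ N.places) (hu : N.F u r) (hs : N.F r s) :
    ν r + σ.count s = μ r + σ.count u := by
  induction h with
  | nil => simp
  | @cons μ ν a σ he _ ih =>
    have hpre : N.F r a ↔ a = s :=
      ⟨fun h => hT.post_unique hr h hs, fun h => h ▸ hs⟩
    have hpost : N.F a r ↔ a = u :=
      ⟨fun h => hT.pre_unique hr h hu, fun h => h ▸ hu⟩
    have hmarked : a = s → 1 ≤ μ r := fun h => he.2 r (hpre.2 h)
    simp only [fire, hpre, hpost] at ih
    simp only [List.count_cons, beq_iff_eq]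
    split_ifs at * <;> simp_all <;> omega

/-- The pre-transition of an unmarked pre-place of `s` occurs before the first
occurrence of `s`. -/
theorem FireSeq.idxOf_pre_lt [DecidableEq α] (hT : N.IsTNet) {μ ν : α → ℕ} {σ : List α}
    (h : N.FireSeq μ σ ν) {u r s : α} (hr : r ∈ N.places) (hu : N.F u r) (hs : N.F r s)
    (h0 : μ r = 0) (hmem : s ∈ σ) : σ.idxOf u < σ.idxOf s := by
  induction h with
  | nil => simp at hmem
  | @cons μ ν a σ he _ ih =>
    have has : a ≠ s := by
      rintro rfl
      have := he.2 r hs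
      omega
    by_cases hau : a = u
    · subst hau
      rw [List.idxOf_cons_self, List.idxOf_cons_ne _ has]
      omega
    · rw [List.idxOf_cons_ne _ has, List.idxOf_cons_ne _ hau]
      have hau' : ¬ N.F a r := fun h => hau (hT.pre_unique hr h hu)
      have hlt := ih (by simp [fire, h0, hau']) (by simpa [Ne.symm has] using hmem)
      omega

/-- Let `ν` mark only pre-places of `c` in a live T-system whose source transitions are
isolated. A function on transitions that does not decrease across the other places is, at
every transition with a pre-place, at least its value at `c`. -/
theorem le_of_monotone_off_preplaces (hT : N.IsTNet) {ν : α → ℕ} {c : α}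
    (hlive : N.Live ν) (hsrc : ∀ r ∈ N.places, ∀ u, N.F u r → ∃ r', N.F r' u)
    (hν : ∀ r ∈ N.places, 1 ≤ ν r → N.F r c) {f : α → ℕ}
    (hf : ∀ r ∈ N.places, ¬ N.F r c → ∀ u s, N.F u r → N.F r s → f u ≤ f s)
    {s r : α} (hs : s ∈ N.transitions) (hrs : N.F r s) : f c ≤ f s := by
  have step : ∀ ξ : α → ℕ,
      (∀ r ∈ N.places, 1 ≤ ξ r → N.F r c ∨ ∀ u, N.F u r → f c ≤ f u) →
      ∀ r s, s ∈ N.transitions → N.F r s → 1 ≤ ξ r → f c ≤ f s := by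
    intro ξ hξ r s hs hrs h1
    have hr := mem_places_of_edge hs hrs
    by_cases hc : N.F r c
    · rw [hT.post_unique hr hrs hc]
    · obtain ⟨u, hu⟩ := (hT r hr).1.exists
      exact ((hξ r hr h1).resolve_left hc u hu).trans (hf r hr hc u s hu hrs)
  have inv : ∀ ξ ζ σ, N.FireSeq ξ σ ζ →
      (∀ r ∈ N.places, 1 ≤ ξ r → N.F r c ∨ ∀ u, N.F u r → f c ≤ f u) →
      (∀ r ∈ N.places, 1 ≤ ζ r → N.F r c ∨ ∀ u, N.F u r → f c ≤ f u) := by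
    intro ξ ζ σ h
    induction h with
    | nil => exact id
    | @cons ξ ζ a σ he _ ih =>
      refine fun hξ => ih fun r hr h1 => ?_
      by_cases har : N.F a r
      · obtain ⟨r', hr'⟩ := hsrc r hr a har
        refine Or.inr fun u hu => ?_
        rw [hT.pre_unique hr hu har]
        exact step ξ hξ r' a he.1 hr' (he.2 r' hr')
      · refine hξ r hr ?_
        simp only [fire, if_neg har] at h1
        omega
  obtain ⟨ζ, ⟨σ, hσ⟩, hen⟩ := hlive s hs ν ⟨[], .nil ν⟩
  exact step ζ (inv ν ζ σ hσ fun r hr h1 => Or.inl (hν r hr h1)) r s hs hrs (hen.2 r hrs)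

/-- Backtracking along unmarked places from a transition `u` that occurs in `σ`: if `P` is
preserved when passing from a transition to the pre-transition of an unmarked pre-place, there
is a token-free elementary path from an enabled transition to `u` whose transitions satisfy
`P`. -/
theorem FireSeq.exists_tokenFree_path [DecidableEq α] (hT : N.IsTNet) {μ ν : α → ℕ}
    {σ : List α} (h : N.FireSeq μ σ ν) {P : α → Prop} (hPσ : ∀ u, P u → u ∈ σ)
    (hP : ∀ u s, P s → ∀ r ∈ N.places, μ r = 0 → N.F u r → N.F r s → P u)
    {u : α} (hu : u ∈ N.transitions) (hPu : P u) :
    ∃ (τ : α) (δ : List α), N.Enabled μ τ ∧ δ.head? = some τ ∧ δ.getLast? = some u ∧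
      N.IsPath δ ∧ δ.Nodup ∧ (∀ r ∈ δ, r ∈ N.places → μ r = 0 ∧ ∀ s, N.F r s → s ∈ δ) ∧
      ∀ s ∈ δ, s ∈ N.transitions → P s ∧ σ.idxOf s ≤ σ.idxOf u := by
  induction hn : σ.idxOf u using Nat.strong_induction_on generalizing u with
  | _ n ih =>
    subst hn
    by_cases hen : N.Enabled μ u
    · refine ⟨u, [u], hen, rfl, rfl, ⟨by simp, ?_, List.isChain_singleton u⟩, by simp, ?_, ?_⟩
      · simpa [nodes] using Or.inr hu
      · intro r hr hrp
        rw [List.mem_singleton.1 hr] at hrp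
        exact absurd rfl (ne_of_mem_places_of_mem_transitions hrp hu)
      · intro s hs _
        rw [List.mem_singleton.1 hs]
        exact ⟨hPu, le_rfl⟩
    · obtain ⟨r, hru, h0⟩ : ∃ r, N.F r u ∧ μ r = 0 := by
        by_contra! hcon
        exact hen ⟨hu, fun r hr => Nat.one_le_iff_ne_zero.2 (hcon r hr)⟩
      have hr := mem_places_of_edge hu hru
      obtain ⟨v, hvr⟩ := (hT r hr).1.exists
      have hlt := h.idxOf_pre_lt hT hr hvr hru h0 (hPσ u hPu)
      obtain ⟨τ, δ, hτ, hhead, hlast, ⟨hne, hnodes, hchain⟩, hnodup, hplaces, htrans⟩ :=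
        ih _ hlt (pre_mem_transitions hr hvr) (hP v u hPu r hr h0 hvr hru) rfl
      have huδ : u ∉ δ := fun hmem => by
        have := (htrans u hmem hu).2
        omega
      have hrδ : r ∉ δ := fun hmem => huδ ((hplaces r hmem hr).2 u hru)
      have hneq := ne_of_mem_places_of_mem_transitions hr hu
      refine ⟨τ, δ ++ [r, u], hτ, ?_, by simp, ⟨by simp, ?_, ?_⟩, ?_, ?_, ?_⟩
      · simp [List.head?_append, hhead]
      · intro y hy
        simp only [List.mem_append, List.mem_cons, List.not_mem_nil, or_false] at hy
        rcases hy with hy | rfl | rfl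
        · exact hnodes y hy
        · exact Finset.mem_union_left _ hr
        · exact Finset.mem_union_right _ hu
      · refine hchain.append (by simpa using hru) ?_
        simp [hlast, hvr]
      · rw [List.nodup_append]
        refine ⟨hnodup, by simpa using hneq, ?_⟩
        rintro a ha b hb rfl
        simp only [List.mem_cons, List.not_mem_nil, or_false] at hb
        rcases hb with rfl | rfl
        · exact hrδ ha
        · exact huδ ha
      · intro y hy hyp
        simp only [List.mem_append, List.mem_cons, List.not_mem_nil, or_false] at hy ⊢
        rcases hy with hy | rfl | rfl
        · exact ⟨(hplaces y hy hyp).1, fun s hs => Or.inl ((hplaces y hy hyp).2 s hs)⟩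
        · exact ⟨h0, fun s hs => Or.inr (Or.inr (hT.post_unique hr hs hru))⟩
        · exact absurd rfl (ne_of_mem_places_of_mem_transitions hyp hu)
      · intro y hy hyt
        simp only [List.mem_append, List.mem_cons, List.not_mem_nil, or_false] at hy
        rcases hy with hy | rfl | rfl
        · exact ⟨(htrans y hy hyt).1, (htrans y hy hyt).2.trans hlt.le⟩
        · exact absurd rfl (ne_of_mem_places_of_mem_transitions hr hyt)
        · exact ⟨hPu, le_rfl⟩

end Auxiliary

end Net

/-- **Token-free enabling paths avoiding the regeneration transition.** In a
perpetual T-system `(TN, μ)` with regeneration cluster `cl` and its unique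
transition `t_cl`: if a transition `t` has a pre-place `p` with `μ p = 1` and a
pre-place `q` with `μ q = 0`, then there is a transition `τ` enabled at `μ`
and an elementary path `δ = (τ, …, q, t)` with `‖μ‖_δ = 0` whose initial
segment `δ_seg = (τ, …, q)` avoids `t_cl`. -/
theorem perpetual_tSystem_exists_tokenFree_path_avoiding_tcl
    {α : Type*} [DecidableEq α] (TN : Net α) (μ : α → ℕ)
    (hT : TN.IsTNet) (cl : Set α) (hperp : TN.Perpetual μ cl)
    (tcl : α) (htcl : tcl ∈ cl ∧ tcl ∈ TN.transitions)
    (t p q : α) (ht : t ∈ TN.transitions)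
    (hp : TN.F p t) (hp1 : μ p = 1) (hq : TN.F q t) (hq0 : μ q = 0) :
    ∃ (τ : α) (δseg : List α),
      TN.Enabled μ τ ∧ δseg.head? = some τ ∧ δseg.getLast? = some q ∧
      TN.IsPath (δseg ++ [t]) ∧ (δseg ++ [t]).Nodup ∧
      TN.tokenCount μ (δseg ++ [t]).toFinset = 0 ∧ tcl ∉ δseg := by
  obtain ⟨hlive, hbdd, hcl, hhome⟩ := hperp
  obtain ⟨htclmem, htcltr⟩ := htcl
  obtain ⟨ν, ⟨σ, hσ⟩, hνcl⟩ := hhome μ ⟨[], .nil μ⟩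
  have hν : ∀ r ∈ TN.places, ν r = if TN.F r tcl then 1 else 0 := fun r hr => by
    rw [hνcl r hr, Net.clusterMarking]
    simp only [hr, and_true, hT.mem_cluster_iff hcl htclmem htcltr hr]
  have hpP := Net.mem_places_of_edge ht hp
  have hqP := Net.mem_places_of_edge ht hq
  have hmin : ∀ s ∈ TN.transitions, ∀ r, TN.F r s → σ.count tcl ≤ σ.count s := by
    intro s hs r hrs
    refine Net.le_of_monotone_off_preplaces (ν := ν) (f := fun a => σ.count a) hT
      (fun a ha ξ hξ => hlive a ha ξ (Net.Reach.trans ⟨σ, hσ⟩ hξ))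
      (fun r hr u hu => hbdd.exists_pre hr hu) ?_ ?_ hs hrs
    · intro r hr h1
      by_contra hc
      simp [hν r hr, hc] at h1
    · intro r hr hc u v hu hv
      have := hσ.marking_add_count hT hr hu hv
      rw [hν r hr, if_neg hc] at this
      omega
  have htpos : t ≠ tcl → σ.count tcl < σ.count t := by
    intro hne
    obtain ⟨u, hu⟩ := (hT p hpP).1.exists
    obtain ⟨r, hr⟩ := hbdd.exists_pre hpP hu
    have hle := hmin u (Net.pre_mem_transitions hpP hu) r hr
    have heq := hσ.marking_add_count hT hpP hu hp
    rw [hν p hpP, if_neg fun h => hne (hT.post_unique hpP hp h)] at heq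
    omega
  obtain ⟨u, hu⟩ := (hT q hqP).1.exists
  have hupos : σ.count tcl < σ.count u := by
    have heq := hσ.marking_add_count hT hqP hu hq
    by_cases hne : t = tcl
    · rw [hν q hqP, if_pos (hne ▸ hq), hne] at heq
      omega
    · have := htpos hne
      rw [hν q hqP, if_neg fun h => hne (hT.post_unique hqP hq h)] at heq
      omega
  obtain ⟨τ, δ, hτ, hhead, hlast, ⟨hne, hnodes, hchain⟩, hnodup, hplaces, htrans⟩ :=
    hσ.exists_tokenFree_path hT (P := fun s => σ.count tcl < σ.count s)
      (fun s hs => List.count_pos_iff.1 (Nat.zero_lt_of_lt hs))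
      (fun a s hs r hr h0 ha hrs => by
        have heq := hσ.marking_add_count hT hr ha hrs
        have hc : ¬ TN.F r tcl := fun h => by
          rw [hT.post_unique hr hrs h] at hs
          exact lt_irrefl _ hs
        rw [hν r hr, if_neg hc] at heq
        omega)
      (Net.pre_mem_transitions hqP hu) hupos
  have htclδ : tcl ∉ δ := fun h => lt_irrefl _ (htrans tcl h htcltr).1
  have htδ : t ∉ δ := by
    intro hmem
    have hne : t ≠ tcl := fun h => htclδ (h ▸ hmem)
    have hlt := hσ.idxOf_pre_lt hT hqP hu hq hq0
      (List.count_pos_iff.1 (Nat.zero_lt_of_lt (htpos hne)))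
    have := (htrans t hmem ht).2
    omega
  have hqδ : q ∉ δ := fun h => htδ ((hplaces q h hqP).2 t hq)
  have hqt := Net.ne_of_mem_places_of_mem_transitions hqP ht
  refine ⟨τ, δ ++ [q], hτ, by simp [List.head?_append, hhead], by simp, ?_, ?_, ?_, ?_⟩
  · rw [List.append_assoc]
    refine ⟨by simp, ?_, hchain.append (by simpa using hq) (by simp [hlast, hu])⟩
    intro y hy
    simp only [List.mem_append, List.mem_cons, List.not_mem_nil, or_false] at hy
    rcases hy with hy | rfl | rfl
    · exact hnodes y hy
    · exact Finset.mem_union_left _ hqP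
    · exact Finset.mem_union_right _ ht
  · rw [List.append_assoc, List.nodup_append]
    refine ⟨hnodup, by simpa using hqt, ?_⟩
    rintro a ha b hb rfl
    simp only [List.mem_append, List.mem_cons, List.not_mem_nil, or_false] at hb
    rcases hb with rfl | rfl
    · exact hqδ ha
    · exact htδ ha
  · refine Finset.sum_eq_zero fun y hy => ?_
    obtain ⟨hyδ, hyP⟩ := Finset.mem_inter.1 hy
    simp only [List.mem_toFinset, List.mem_append, List.mem_cons, List.not_mem_nil,
      or_false] at hyδ
    rcases hyδ with (hyδ | rfl) | rfl
    · exact (hplaces y hyδ hyP).1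
    · exact hq0
    · exact absurd rfl (Net.ne_of_mem_places_of_mem_transitions hyP ht)
  · simp only [List.mem_append, List.mem_singleton, not_or]
    exact ⟨htclδ, fun h => Net.ne_of_mem_places_of_mem_transitions hqP htcltr h.symm⟩
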